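/- (Multiplicity-free coproduct of a rectangle) Let p, q ≥ 1 and let R = (q^p) be the rectangular partition with p rows and q columns. For a partition μ ⊆ R let μ̂ ⊆ R be μ rotated 180 degrees and placed in the lower-right corner of R, i.e. μ̂ = {(i,j) : 1 ≤ i ≤ p, q − μ_{p+1−i} < j ≤ q} (with μ_k = 0 for k > ℓ(μ)). Then for all partitions λ and μ: d^R_{λμ} = (−1)^{|λ|+|μ|−pq} if λ ⊆ R, μ ⊆ R, λ ∪ μ̂ = R, and λ ∩ μ̂ is a rook strip; and d^R_{λμ} = 0 in all other cases. -/

import Mathlib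

open MvPolynomial

/-- A set-valued tableau on an arbitrary finite set of boxes `(row, column)`.
Entries are `0`-based: the entry `i : ℕ` stands for the integer `i + 1`
(equivalently, for the variable `x_{i+1}`).  Rows weakly increase from left to
right and columns strictly increase from top to bottom, expressed via
horizontally and vertically adjacent boxes. -/
structure SVT (cells : Finset (ℕ × ℕ)) where
  entry : ℕ × ℕ → Finset ℕ
  nonempty_of_mem : ∀ c ∈ cells, (entry c).Nonempty
  eq_empty_of_not_mem : ∀ c, c ∉ cells → entry c = ∅
  row_weak : ∀ i j, (i, j) ∈ cells → (i, j + 1) ∈ cells →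
    ∀ a ∈ entry (i, j), ∀ b ∈ entry (i, j + 1), a ≤ b
  col_strict : ∀ i j, (i, j) ∈ cells → (i + 1, j) ∈ cells →
    ∀ a ∈ entry (i, j), ∀ b ∈ entry (i + 1, j), a < b

namespace SVT

variable {cells : Finset (ℕ × ℕ)}

/-- `|T|`: the total number of integers in the boxes of `T`. -/
def size (T : SVT cells) : ℕ := ∑ c ∈ cells, (T.entry c).card

/-- `T` has all its entries among `{1, …, m}` (i.e. `0`-based entries `< m`). -/
def Bounded (T : SVT cells) (m : ℕ) : Prop := ∀ c, ∀ x ∈ T.entry c, x < m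

/-- The monomial `x^T`, where the exponent of the variable `i` is the number of
boxes of `T` containing `i`. -/
noncomputable def monomial (T : SVT cells) : MvPolynomial ℕ ℤ :=
  ∏ c ∈ cells, ∏ i ∈ T.entry c, X i

/-- The column word of `T`: columns are read from left to right, each column
from bottom to top, the integers within a box in increasing order. -/
def word (T : SVT cells) : List ℕ :=
  (List.range ((cells.sup fun c => max c.1 c.2) + 1)).flatMap fun j =>
    ((List.range ((cells.sup fun c => max c.1 c.2) + 1)).reverse).flatMap fun i =>
      (T.entry (i, j)).sort (· ≤ ·)

end SVT

/-- The stable Grothendieck polynomial of the shape given by `cells`, in the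
variables `x_1, …, x_m` (`0`-based: variables `0, …, m-1`):
`G(cells) = ∑_T (-1)^(|T| - #cells) x^T` over set-valued tableaux `T` of shape
`cells` with entries in `{1, …, m}`. -/
noncomputable def grothendieck (cells : Finset (ℕ × ℕ)) (m : ℕ) : MvPolynomial ℕ ℤ :=
  ∑ᶠ (T : SVT cells) (_ : T.Bounded m), ((-1 : ℤ) ^ (T.size - cells.card)) • T.monomial

/-- A reverse lattice word: every suffix contains, for each `i`, at least as
many occurrences of `i` as of `i + 1`. -/
def IsRLW (w : List ℕ) : Prop := ∀ s, s <:+ w → ∀ i, s.count (i + 1) ≤ s.count i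

/-- A partial reverse lattice word with respect to the (`0`-based, half-open)
interval `[a, b)`:  every suffix contains, for each `t` with `a ≤ t` and
`t + 1 < b`, at least as many occurrences of `t` as of `t + 1`. -/
def IsPartialRLW (a b : ℕ) (w : List ℕ) : Prop :=
  ∀ s, s <:+ w → ∀ t, a ≤ t → t + 1 < b → s.count (t + 1) ≤ s.count t

/-- `w` has content `ν`: the number of occurrences of `i` in `w` is the length
of the `i`-th row of `ν`. -/
def HasContent (w : List ℕ) (nu : YoungDiagram) : Prop := ∀ i, w.count i = nu.rowLen i

/-- The cells of the skew diagram `λ * μ`, obtained by placing `λ` and `μ`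
corner to corner: `λ` occupies rows `0, …, ℓ(λ)-1` shifted right by `μ₁`
columns, and `μ` occupies the rows below row `ℓ(λ)-1`. -/
def starCells (lam mu : YoungDiagram) : Finset (ℕ × ℕ) :=
  (lam.cells.image fun c => (c.1, c.2 + mu.rowLen 0)) ∪
    (mu.cells.image fun c => (c.1 + lam.colLen 0, c.2))

/-- The structure constant `c^ν_{λμ}`: `(-1)^(|ν|-|λ|-|μ|)` times the number of
set-valued tableaux of shape `λ * μ` whose word is a reverse lattice word with
content `ν`. -/
noncomputable def cLR (lam mu nu : YoungDiagram) : ℤ :=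
  (-1 : ℤ) ^ (nu.card - lam.card - mu.card) *
    (Nat.card {T : SVT (starCells lam mu) // IsRLW T.word ∧ HasContent T.word nu} : ℤ)

/-- The coproduct structure constant `d^ν_{λμ}`: `(-1)^(|λ|+|μ|-|ν|)` times the
number of set-valued tableaux of shape `ν` whose word is a partial reverse
lattice word with respect to both intervals `[1, ℓ(λ)]` and
`[ℓ(λ)+1, ℓ(λ)+ℓ(μ)]` and has content `(λ₁, …, λ_{ℓ(λ)}, μ₁, …, μ_{ℓ(μ)})`. -/
noncomputable def dCoeff (lam mu nu : YoungDiagram) : ℤ :=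
  (-1 : ℤ) ^ (lam.card + mu.card - nu.card) *
    (Nat.card {T : SVT nu.cells //
      IsPartialRLW 0 (lam.colLen 0) T.word ∧
      IsPartialRLW (lam.colLen 0) (lam.colLen 0 + mu.colLen 0) T.word ∧
      ∀ i, T.word.count i =
        if i < lam.colLen 0 then lam.rowLen i else mu.rowLen (i - lam.colLen 0)} : ℤ)

/-- The coefficient `α_{θ,μ}` for a shape `θ` given by `cells`:
`(-1)^(|μ|-|θ|)` times the number of set-valued tableaux of shape `θ` whose
word is a reverse lattice word with content `μ`. -/
noncomputable def alphaCoeff (cells : Finset (ℕ × ℕ)) (mu : YoungDiagram) : ℤ :=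
  (-1 : ℤ) ^ (mu.card - cells.card) *
    (Nat.card {T : SVT cells // IsRLW T.word ∧ HasContent T.word mu} : ℤ)

/-- `ν/λ` is a vertical strip: at most one box in each row. -/
def IsVerticalStrip (lam nu : YoungDiagram) : Prop := ∀ i, nu.rowLen i ≤ lam.rowLen i + 1

/-- `ν/λ` is a horizontal strip: at most one box in each column. -/
def IsHorizontalStrip (lam nu : YoungDiagram) : Prop := ∀ j, nu.colLen j ≤ lam.colLen j + 1

/-- A set of boxes is a rook strip if it has at most one box in each row and in
each column. -/
def IsRookStripCells (s : Finset (ℕ × ℕ)) : Prop :=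
  (∀ i, (s.filter fun c => c.1 = i).card ≤ 1) ∧ (∀ j, (s.filter fun c => c.2 = j).card ≤ 1)

/-- The rectangular Young diagram with `p` rows and `q` columns. -/
def rect (p q : ℕ) : YoungDiagram :=
  ⟨Finset.range p ×ˢ Finset.range q, by
    intro a b hba ha
    simp only [Finset.coe_product, Set.mem_prod, Finset.mem_coe, Finset.mem_range] at ha ⊢
    exact ⟨lt_of_le_of_lt hba.1 ha.1, lt_of_le_of_lt hba.2 ha.2⟩⟩
/-- The partition `μ ⊆ (q^p)` rotated 180 degrees and placed in the lower-right
corner of the `p × q` rectangle. -/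
def muHat (p q : ℕ) (mu : YoungDiagram) : Finset (ℕ × ℕ) :=
  (Finset.range p ×ˢ Finset.range q).filter fun c => q - mu.rowLen (p - 1 - c.1) ≤ c.2

theorem List.forall_suffix_count_le_iff (w : List ℕ) (t : ℕ) :
    (∀ s, s <:+ w → s.count (t + 1) ≤ s.count t) ↔
      ∀ s, (t + 1) :: s <:+ w → s.count (t + 1) < s.count t := by
  constructor
  · intro h s hs
    have := h _ hs
    simp at this
    omega
  · intro h s
    induction s with
    | nil => simp
    | cons x s ih =>
      intro hs
      have hs' := ih ((List.suffix_cons x s).trans hs)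
      by_cases hx : x = t + 1
      · subst hx
        have := h s hs
        simp
        omega
      · rw [List.count_cons_of_ne hx, List.count_cons]
        omega

theorem List.exists_split_of_cons_suffix_flatMap {α β : Type*} (g : α → List β) (L : List α)
    (x : β) (s : List β) (h : x :: s <:+ L.flatMap g) :
    ∃ L₁ c L₂ l₁ l₂, L = L₁ ++ c :: L₂ ∧ g c = l₁ ++ x :: l₂ ∧ s = l₂ ++ L₂.flatMap g := by
  induction L with
  | nil => simp at h
  | cons c L ih =>
    obtain ⟨r, hr⟩ := h
    rw [List.flatMap_cons, List.append_eq_append_iff] at hr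
    rcases hr with ⟨u, hu, hv⟩ | ⟨u, hu, hv⟩
    · cases u with
      | nil =>
        obtain ⟨L₁, c', L₂, l₁, l₂, h1, h2, h3⟩ := ih ⟨[], by simpa using hv⟩
        exact ⟨c :: L₁, c', L₂, l₁, l₂, by simp [h1], h2, h3⟩
      | cons y u =>
        simp only [List.cons_append, List.cons.injEq] at hv
        obtain ⟨rfl, hv⟩ := hv
        exact ⟨[], c, L, r, u, by simp, hu, hv⟩
    · obtain ⟨L₁, c', L₂, l₁, l₂, h1, h2, h3⟩ := ih ⟨u, hv.symm⟩
      exact ⟨c :: L₁, c', L₂, l₁, l₂, by simp [h1], h2, h3⟩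

/-- `ReadAfter c d`: the column reading order visits the box `d` after the box `c`. -/
def ReadAfter (c d : ℕ × ℕ) : Prop := c.2 < d.2 ∨ c.2 = d.2 ∧ d.1 < c.1

instance (c : ℕ × ℕ) : DecidablePred (ReadAfter c) := fun d => by
  unfold ReadAfter
  infer_instance

/-- The boxes of an `N × N` square in column reading order. -/
def readingList (N : ℕ) : List (ℕ × ℕ) :=
  (List.range N).flatMap fun j => (List.range N).reverse.map fun i => (i, j)

theorem mem_readingList {N : ℕ} {c : ℕ × ℕ} : c ∈ readingList N ↔ c.1 < N ∧ c.2 < N := by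
  obtain ⟨i, j⟩ := c
  simp [readingList, and_comm]

theorem pairwise_readingList (N : ℕ) : (readingList N).Pairwise ReadAfter := by
  rw [readingList, List.pairwise_flatMap]
  refine ⟨fun j _ => ?_, List.pairwise_lt_range.imp ?_⟩
  · rw [List.pairwise_map, List.pairwise_reverse]
    exact List.pairwise_lt_range.imp fun h => Or.inr ⟨rfl, h⟩
  · rintro j j' hj x hx y hy
    simp only [List.mem_map] at hx hy
    obtain ⟨_, -, rfl⟩ := hx
    obtain ⟨_, -, rfl⟩ := hy
    exact Or.inl hj

theorem ReadAfter.ne {c d : ℕ × ℕ} (h : ReadAfter c d) : c ≠ d := by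
  rintro rfl
  simp [ReadAfter] at h

theorem ReadAfter.not_symm {c d : ℕ × ℕ} (h : ReadAfter c d) : ¬ReadAfter d c := by
  simp only [ReadAfter] at *
  omega

namespace SVT

variable {cells : Finset (ℕ × ℕ)}

theorem word_eq_flatMap (T : SVT cells) :
    T.word = (readingList ((cells.sup fun c => max c.1 c.2) + 1)).flatMap
      fun c => (T.entry c).sort (· ≤ ·) := by
  simp only [word, readingList, List.flatMap_assoc, List.flatMap_map]

theorem mem_cells_of_mem_entry (T : SVT cells) {c : ℕ × ℕ} {x : ℕ} (h : x ∈ T.entry c) :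
    c ∈ cells := by
  by_contra hc
  simp [T.eq_empty_of_not_mem c hc] at h

theorem mem_readingList_of_mem {c : ℕ × ℕ} (h : c ∈ cells) :
    c ∈ readingList ((cells.sup fun c => max c.1 c.2) + 1) := by
  have := Finset.le_sup (f := fun c : ℕ × ℕ => max c.1 c.2) h
  simp only [mem_readingList] at *
  omega

theorem count_flatMap_sort (T : SVT cells) (L : List (ℕ × ℕ)) (hL : L.Nodup) (t : ℕ) :
    (L.flatMap fun c => (T.entry c).sort (· ≤ ·)).count t =
      (cells.filter fun c => c ∈ L ∧ t ∈ T.entry c).card := by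
  have h1 : (L.flatMap fun c => (T.entry c).sort (· ≤ ·)).count t =
      (L.filter fun c => t ∈ T.entry c).length := by
    clear hL
    induction L with
    | nil => simp
    | cons c L ih =>
      rw [List.flatMap_cons, List.count_append, ih, List.filter_cons]
      by_cases h : t ∈ T.entry c
      · rw [List.count_eq_one_of_mem (Finset.sort_nodup _ _) (by simpa using h)]
        simp [h, add_comm]
      · rw [List.count_eq_zero_of_not_mem (by simpa using h)]
        simp [h]
  rw [h1, ← List.toFinset_card_of_nodup (hL.filter _)]
  congr 1
  ext c
  simp only [List.mem_toFinset, List.mem_filter, Finset.mem_filter, decide_eq_true_eq]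
  exact ⟨fun h => ⟨T.mem_cells_of_mem_entry h.2, h⟩, fun h => h.2⟩

theorem count_word (T : SVT cells) (t : ℕ) :
    T.word.count t = (cells.filter fun c => t ∈ T.entry c).card := by
  rw [word_eq_flatMap, count_flatMap_sort _ _ ((pairwise_readingList _).imp ReadAfter.ne)]
  congr 1
  ext c
  simp only [Finset.mem_filter]
  exact ⟨fun h => ⟨h.1, h.2.2⟩, fun h => ⟨h.1, mem_readingList_of_mem h.1, h.2⟩⟩

/-- The lattice condition for `t` and `t + 1`, in terms of the boxes of the tableau. -/
theorem forall_suffix_word_iff (T : SVT cells) (t : ℕ) :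
    (∀ s, s <:+ T.word → s.count (t + 1) ≤ s.count t) ↔
      ∀ c, t + 1 ∈ T.entry c →
        (cells.filter fun d => ReadAfter c d ∧ t + 1 ∈ T.entry d).card <
          (cells.filter fun d => ReadAfter c d ∧ t ∈ T.entry d).card := by
  rw [List.forall_suffix_count_le_iff, word_eq_flatMap]
  set L := readingList ((cells.sup fun c => max c.1 c.2) + 1) with hLdef
  have hP : L.Pairwise ReadAfter := pairwise_readingList _
  have hN : L.Nodup := hP.imp ReadAfter.ne
  have key : ∀ L₁ c L₂ l₁ l₂, L = L₁ ++ c :: L₂ →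
      (T.entry c).sort (· ≤ ·) = l₁ ++ (t + 1) :: l₂ → ∀ u, u ≤ t + 1 →
      (l₂ ++ L₂.flatMap fun c => (T.entry c).sort (· ≤ ·)).count u =
        (cells.filter fun d => ReadAfter c d ∧ u ∈ T.entry d).card := by
    intro L₁ c L₂ l₁ l₂ hL hl u hu
    have hs : ((T.entry c).sort (· ≤ ·)).Pairwise (· < ·) :=
      Finset.sortedLT_sort _ |>.pairwise
    rw [hl, List.pairwise_append, List.pairwise_cons] at hs
    have hul : u ∉ l₂ := fun h => by
      have := hs.2.1.1 u h
      omega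
    rw [hL] at hP hN
    rw [List.count_append, List.count_eq_zero_of_not_mem hul, zero_add,
      count_flatMap_sort _ _ (List.nodup_cons.1 (List.nodup_append.1 hN).2.1).2]
    congr 1
    ext d
    simp only [Finset.mem_filter]
    refine and_congr_right fun hd => and_congr_left fun _ => ?_
    have hdL : d ∈ L := mem_readingList_of_mem hd
    rw [List.pairwise_append, List.pairwise_cons] at hP
    refine ⟨hP.2.1.1 d, fun h => ?_⟩
    rw [hL, List.mem_append, List.mem_cons] at hdL
    rcases hdL with hd' | rfl | hd'
    · exact absurd h (hP.2.2 d hd' c (by simp)).not_symm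
    · exact absurd rfl h.ne
    · exact hd'
  constructor
  · intro h c hc
    obtain ⟨L₁, L₂, hL⟩ := List.append_of_mem
      (mem_readingList_of_mem (T.mem_cells_of_mem_entry hc))
    rw [← hLdef] at hL
    obtain ⟨l₁, l₂, hl⟩ := List.append_of_mem ((Finset.mem_sort (· ≤ ·)).2 hc)
    rw [← key L₁ c L₂ l₁ l₂ hL hl _ le_rfl, ← key L₁ c L₂ l₁ l₂ hL hl _ (Nat.le_succ t)]
    refine h _ ⟨L₁.flatMap (fun c => (T.entry c).sort (· ≤ ·)) ++ l₁, ?_⟩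
    rw [hL, List.flatMap_append, List.flatMap_cons, hl]
    simp
  · intro h s hs
    obtain ⟨L₁, c, L₂, l₁, l₂, hL, hl, rfl⟩ := List.exists_split_of_cons_suffix_flatMap _ _ _ _ hs
    have hc : t + 1 ∈ T.entry c := by
      rw [← Finset.mem_sort (· ≤ ·), hl]
      simp
    rw [key L₁ c L₂ l₁ l₂ hL hl _ le_rfl, key L₁ c L₂ l₁ l₂ hL hl _ (Nat.le_succ t)]
    exact h c hc

end SVT

@[simp]
theorem mem_rect {p q : ℕ} {c : ℕ × ℕ} : c ∈ rect p q ↔ c.1 < p ∧ c.2 < q := by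
  simp [rect, ← YoungDiagram.mem_cells]

theorem mem_cells_rect {p q : ℕ} {c : ℕ × ℕ} : c ∈ (rect p q).cells ↔ c.1 < p ∧ c.2 < q := by
  simp

theorem mem_muHat {p q : ℕ} {mu : YoungDiagram} {c : ℕ × ℕ} :
    c ∈ muHat p q mu ↔ (c.1 < p ∧ c.2 < q) ∧ (p - 1 - c.1, q - 1 - c.2) ∈ mu := by
  simp only [muHat, Finset.mem_filter, Finset.mem_product, Finset.mem_range,
    YoungDiagram.mem_iff_lt_rowLen]
  refine and_congr_right fun h => ?_
  omega

/-- A downward closed subset of `range q` is an initial segment. -/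
theorem lt_card_filter_range_iff {q : ℕ} {P : ℕ → Prop} [DecidablePred P]
    (hP : ∀ j j', j ≤ j' → j' < q → P j' → P j) {j : ℕ} :
    j < ((Finset.range q).filter P).card ↔ j < q ∧ P j := by
  constructor
  · intro h
    by_contra hj
    have hsub : (Finset.range q).filter P ⊆ Finset.range j := by
      intro x hx
      simp only [Finset.mem_filter, Finset.mem_range] at hx ⊢
      by_contra hxj
      exact hj ⟨by omega, hP j x (by omega) hx.1 hx.2⟩
    have := Finset.card_le_card hsub
    simp at this
    omega
  · rintro ⟨hj, hPj⟩
    have hsub : Finset.range (j + 1) ⊆ (Finset.range q).filter P := by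
      intro x hx
      simp only [Finset.mem_filter, Finset.mem_range] at hx ⊢
      exact ⟨by omega, hP x j (by omega) hj hPj⟩
    have := Finset.card_le_card hsub
    simp at this
    omega

/-- An upward closed subset of `range q` is a final segment. -/
theorem lt_card_filter_range_iff_reflect {q : ℕ} {P : ℕ → Prop} [DecidablePred P]
    (hP : ∀ j j', j ≤ j' → j' < q → P j → P j') {j : ℕ} (hj : j < q) :
    q - 1 - j < ((Finset.range q).filter P).card ↔ P j := by
  have h : ((Finset.range q).filter P).card =
      ((Finset.range q).filter fun j => P (q - 1 - j)).card := by
    refine Finset.card_bij' (fun j _ => q - 1 - j) (fun j _ => q - 1 - j) ?_ ?_ ?_ ?_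
    · intro x hx
      simp only [Finset.mem_filter, Finset.mem_range] at hx ⊢
      rw [show q - 1 - (q - 1 - x) = x by omega]
      exact ⟨by omega, hx.2⟩
    · intro x hx
      simp only [Finset.mem_filter, Finset.mem_range] at hx ⊢
      exact ⟨by omega, hx.2⟩
    all_goals
      intro x hx
      simp only [Finset.mem_filter, Finset.mem_range] at hx
      omega
  rw [h, lt_card_filter_range_iff fun x y hxy hy hPy => hP _ _ (by omega) (by omega) hPy,
    show q - 1 - (q - 1 - j) = j by omega]
  exact and_iff_right (by omega)

/-- An upward closed subset of `range p` consists of the elements above some threshold. -/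
theorem exists_threshold (p : ℕ) (P : ℕ → Prop) (hP : ∀ i i', i ≤ i' → i' < p → P i → P i') :
    ∃ s, s ≤ p ∧ ∀ i, i < p → (P i ↔ s ≤ i) := by
  classical
  by_cases h : ∃ i, i < p ∧ P i
  · refine ⟨Nat.find h, (Nat.find_spec h).1.le, fun i hi => ⟨fun hPi => ?_, fun hle => ?_⟩⟩
    · exact Nat.find_min' h ⟨hi, hPi⟩
    · exact hP _ _ hle hi (Nat.find_spec h).2
  · refine ⟨p, le_rfl, fun i hi => ⟨fun hPi => absurd ⟨i, hi, hPi⟩ h, fun hle => by omega⟩⟩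

namespace SVT

variable {p q : ℕ} (T : SVT (rect p q).cells)

theorem lt_of_mem_entry_rect {i j x : ℕ} (h : x ∈ T.entry (i, j)) : i < p ∧ j < q := by
  simpa using T.mem_cells_of_mem_entry h

theorem entry_rect_nonempty {i j : ℕ} (hi : i < p) (hj : j < q) : (T.entry (i, j)).Nonempty :=
  T.nonempty_of_mem _ (by simp [hi, hj])

theorem lt_of_row_lt {i i' j x y : ℕ} (hi : i < i') (hx : x ∈ T.entry (i, j))
    (hy : y ∈ T.entry (i', j)) : x < y := by
  have hj := (T.lt_of_mem_entry_rect hx).2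
  induction i', hi using Nat.le_induction generalizing y with
  | base =>
    have := (T.lt_of_mem_entry_rect hy).1
    exact T.col_strict i j (by simp; omega) (by simp; omega) x hx y hy
  | succ k hk ih =>
    have := (T.lt_of_mem_entry_rect hy).1
    obtain ⟨z, hz⟩ := T.entry_rect_nonempty (i := k) (j := j) (by omega) hj
    exact (ih hz).trans (T.col_strict k j (by simp; omega) (by simp; omega) z hz y hy)

theorem le_of_col_lt {i j j' x y : ℕ} (hj : j < j') (hx : x ∈ T.entry (i, j))
    (hy : y ∈ T.entry (i, j')) : x ≤ y := by
  have hi := (T.lt_of_mem_entry_rect hx).1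
  induction j', hj using Nat.le_induction generalizing y with
  | base =>
    have := (T.lt_of_mem_entry_rect hy).2
    exact T.row_weak i j (by simp; omega) (by simp; omega) x hx y hy
  | succ k hk ih =>
    have := (T.lt_of_mem_entry_rect hy).2
    obtain ⟨z, hz⟩ := T.entry_rect_nonempty (i := i) (j := k) hi (by omega)
    exact (ih hz).trans (T.row_weak i k (by simp; omega) (by simp; omega) z hz y hy)

theorem row_eq_of_mem {i i' j x : ℕ} (hx : x ∈ T.entry (i, j)) (hx' : x ∈ T.entry (i', j)) :
    i = i' := by
  rcases lt_trichotomy i i' with h | h | h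
  · exact absurd (T.lt_of_row_lt h hx hx') (lt_irrefl _)
  · exact h
  · exact absurd (T.lt_of_row_lt h hx' hx) (lt_irrefl _)

/-- The multiplicity of `t` is the number of columns containing `t`. -/
theorem count_word_rect (t : ℕ) {P : ℕ → Prop} [DecidablePred P]
    (hP : ∀ j, j < q → (P j ↔ ∃ i, t ∈ T.entry (i, j))) :
    T.word.count t = ((Finset.range q).filter P).card := by
  rw [count_word]
  refine Finset.card_bij (fun c _ => c.2) ?_ ?_ ?_
  · rintro ⟨i, j⟩ hc
    simp only [Finset.mem_filter, mem_cells_rect, Finset.mem_range] at hc ⊢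
    exact ⟨hc.1.2, (hP j hc.1.2).2 ⟨i, hc.2⟩⟩
  · rintro ⟨i, j⟩ hc ⟨i', j'⟩ hc' (rfl : j = j')
    simp only [Finset.mem_filter] at hc hc'
    rw [T.row_eq_of_mem hc.2 hc'.2]
  · intro j hj
    simp only [Finset.mem_filter, Finset.mem_range] at hj
    obtain ⟨i, hi⟩ := (hP j hj.1).1 hj.2
    exact ⟨(i, j), by simpa [hi] using T.lt_of_mem_entry_rect hi, rfl⟩

/-- If every occurrence of `t + 1` has an occurrence of `t` just above it, then the word satisfies
the lattice condition for `t` and `t + 1`. -/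
theorem suffix_count_le_of_above {t : ℕ}
    (h : ∀ i j, t + 1 ∈ T.entry (i, j) → ∃ i', i = i' + 1 ∧ t ∈ T.entry (i', j)) :
    ∀ s, s <:+ T.word → s.count (t + 1) ≤ s.count t := by
  rw [forall_suffix_word_iff]
  rintro ⟨i, j⟩ hc
  obtain ⟨k, rfl, hk⟩ := h i j hc
  set A := (rect p q).cells.filter fun d => ReadAfter (k + 1, j) d ∧ t + 1 ∈ T.entry d
  have hA : ∀ d ∈ A, j < d.2 ∧ ∃ i', d.1 = i' + 1 ∧ t ∈ T.entry (i', d.2) := by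
    rintro ⟨i', j'⟩ hd
    rw [Finset.mem_filter] at hd
    refine ⟨?_, h i' j' hd.2.2⟩
    rcases hd.2.1 with h' | ⟨h', h''⟩
    · exact h'
    · obtain rfl : j = j' := h'
      have := T.row_eq_of_mem hc hd.2.2
      simp at h''
      omega
  have hinj : Set.InjOn (fun d : ℕ × ℕ => (d.1 - 1, d.2)) A := by
    rintro ⟨x, y⟩ hd ⟨x', y'⟩ hd' he
    obtain ⟨-, i₁, h1, -⟩ := hA _ hd
    obtain ⟨-, i₂, h2, -⟩ := hA _ hd'
    simp only [Prod.mk.injEq] at *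
    omega
  rw [← Finset.card_image_of_injOn hinj]
  refine Finset.card_lt_card ((Finset.ssubset_iff_of_subset ?_).2 ⟨(k, j), ?_, ?_⟩)
  · intro d hd
    obtain ⟨⟨x, y⟩, hxy, rfl⟩ := Finset.mem_image.1 hd
    obtain ⟨hj, i', h1, h2⟩ := hA _ hxy
    obtain rfl : x = i' + 1 := h1
    rw [Finset.mem_filter, mem_cells_rect]
    exact ⟨T.lt_of_mem_entry_rect h2, Or.inl hj, h2⟩
  · rw [Finset.mem_filter, mem_cells_rect]
    exact ⟨T.lt_of_mem_entry_rect hk, Or.inr ⟨rfl, by simp⟩, hk⟩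
  · intro hd
    obtain ⟨d, hd, he⟩ := Finset.mem_image.1 hd
    have := (hA d hd).1
    simp only [Prod.mk.injEq] at he
    omega

/-- Induction along the reverse reading order of the boxes of a rectangle. -/
theorem reading_induction {Q : ℕ → ℕ → Prop}
    (h : ∀ i j, (∀ i' j', ReadAfter (i, j) (i', j') → j' < q → Q i' j') → j < q → Q i j)
    (i j : ℕ) (hj : j < q) : Q i j := by
  induction hd : q - j using Nat.strong_induction_on generalizing i j with
  | _ d ihd =>
    induction i using Nat.strong_induction_on with
    | _ i ihi =>
      refine h i j (fun i' j' hr hj' => ?_) hj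
      rcases hr with hr | ⟨hr, hr'⟩
      · exact ihd (q - j') (by simp at hr; omega) i' j' hj' rfl
      · obtain rfl : j = j' := hr
        exact ihi i' hr'

section Small

variable {T} {a : ℕ} (hT : IsPartialRLW 0 a T.word)

include hT in
theorem eq_row_of_mem {i j m : ℕ} (hm : m ∈ T.entry (i, j)) (hma : m < a) : m = i := by
  have hq := (T.lt_of_mem_entry_rect hm).2
  revert m
  refine reading_induction (Q := fun i j => ∀ {m}, m ∈ T.entry (i, j) → m < a → m = i)
    (fun i j ih hj m hm hma => ?_) i j hq
  have hip := (T.lt_of_mem_entry_rect hm).1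
  apply le_antisymm
  · by_contra! hlt
    obtain ⟨t, rfl⟩ : ∃ t, m = t + 1 := ⟨m - 1, by omega⟩
    have hc := (T.forall_suffix_word_iff t).1 (fun s hs => hT s hs t (by omega) hma) _ hm
    obtain ⟨⟨i', j'⟩, hd⟩ := Finset.card_pos.1 (Nat.zero_lt_of_lt hc)
    simp only [Finset.mem_filter, mem_cells_rect] at hd
    obtain ⟨⟨hi', hj'⟩, hr, ht⟩ := hd
    obtain rfl := ih i' j' hr hj' ht (by omega)
    have hjj : j < j' := by
      simp only [ReadAfter] at hr
      omega
    obtain ⟨y, hy, hyt⟩ : ∃ y ∈ T.entry (i, j'), y ≤ t := by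
      rcases (show i ≤ t by omega).lt_or_eq with h | rfl
      · obtain ⟨y, hy⟩ := T.entry_rect_nonempty hip hj'
        exact ⟨y, hy, (T.lt_of_row_lt h hy ht).le⟩
      · exact ⟨i, ht, le_rfl⟩
    have := ih i j' (Or.inl hjj) hj' hy (by omega)
    have := T.le_of_col_lt hjj hm hy
    omega
  · rcases i with _ | i
    · simp
    · obtain ⟨y, hy⟩ := T.entry_rect_nonempty (i := i) (j := j) (by omega) hj
      have h1 := T.lt_of_row_lt (Nat.lt_succ_self i) hy hm
      have h2 := ih i j (Or.inr ⟨rfl, by simp⟩) hj hy (by omega)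
      omega

include hT in
theorem mem_entry_iff_of_lt {lam : YoungDiagram}
    (hcount : ∀ t, t < a → T.word.count t = lam.rowLen t) {i j m : ℕ} (hma : m < a) :
    m ∈ T.entry (i, j) ↔ m = i ∧ j < q ∧ (i, j) ∈ lam := by
  classical
  have hrow : ∀ {j}, m ∈ T.entry (m, j) ↔ j < q ∧ (m, j) ∈ lam := fun {j} => by
    have hdown : ∀ j j', j ≤ j' → j' < q → m ∈ T.entry (m, j') → m ∈ T.entry (m, j) := by
      intro j j' hjj hj' hm
      rcases hjj.eq_or_lt with rfl | hlt
      · exact hm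
      obtain ⟨y, hy⟩ := T.entry_rect_nonempty (T.lt_of_mem_entry_rect hm).1 (hlt.trans hj')
      have := T.le_of_col_lt hlt hy hm
      rwa [eq_row_of_mem hT hy (by omega)] at hy
    have h := T.count_word_rect m (P := fun j => m ∈ T.entry (m, j)) fun j _ =>
      ⟨fun h => ⟨m, h⟩, fun ⟨i, h⟩ => by
        have := eq_row_of_mem hT h hma
        rwa [← this] at h⟩
    rw [YoungDiagram.mem_iff_lt_rowLen, ← hcount m hma, h, lt_card_filter_range_iff hdown]
    exact ⟨fun h => ⟨(T.lt_of_mem_entry_rect h).2, (T.lt_of_mem_entry_rect h).2, h⟩,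
      fun h => h.2.2⟩
  constructor
  · intro h
    obtain rfl := eq_row_of_mem hT h hma
    exact ⟨rfl, hrow.1 h⟩
  · rintro ⟨rfl, h⟩
    exact hrow.2 h

end Small

section Large

variable {T} {a b : ℕ} (hT : IsPartialRLW a (a + b) T.word)
  (hb : ∀ c, ∀ m ∈ T.entry c, m < a + b) {s : ℕ → ℕ}
  (hs : ∀ i j, i < p → j < q → ((∃ m ∈ T.entry (i, j), a ≤ m) ↔ s j ≤ i))

include hT hb hs

theorem add_threshold_eq_of_mem {i j m : ℕ} (hm : m ∈ T.entry (i, j)) (ham : a ≤ m) :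
    m + s j = a + i := by
  have hq := (T.lt_of_mem_entry_rect hm).2
  revert m
  refine reading_induction
    (Q := fun i j => ∀ {m}, m ∈ T.entry (i, j) → a ≤ m → m + s j = a + i)
    (fun i j ih hj m hm ham => ?_) i j hq
  have hip := (T.lt_of_mem_entry_rect hm).1
  have hsi : s j ≤ i := (hs i j hip hj).1 ⟨m, hm, ham⟩
  apply le_antisymm
  · by_contra! hlt
    obtain ⟨t, rfl⟩ : ∃ t, m = t + 1 := ⟨m - 1, by omega⟩
    have hc := (T.forall_suffix_word_iff t).1
      (fun w hw => hT w hw t (by omega) (hb _ _ hm)) _ hm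
    refine absurd hc (not_lt.2 ?_)
    refine Finset.card_le_card_of_injOn (fun d => (d.1 + 1, d.2)) ?_ ?_
    · rintro ⟨i', j'⟩ hd
      rw [Finset.mem_coe, Finset.mem_filter, mem_cells_rect] at hd
      obtain ⟨⟨hi', hj'⟩, hr, ht⟩ := hd
      have ht' := ih i' j' hr hj' ht (by omega)
      have hjj : j < j' := by
        rcases hr with hr | ⟨hr, hr'⟩
        · exact hr
        · obtain rfl : j = j' := hr
          simp at hr'
          omega
      obtain ⟨y, hy⟩ := T.entry_rect_nonempty hip hj'
      have hty := T.le_of_col_lt hjj hm hy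
      have hii : i' < i := by
        rcases lt_trichotomy i i' with h | rfl | h
        · have := T.lt_of_row_lt h hy ht
          omega
        · have := ih i j' hr hj' hy (by omega)
          omega
        · exact h
      obtain ⟨z, hz⟩ := T.entry_rect_nonempty (i := i' + 1) (j := j') (by omega) hj'
      have htz := T.lt_of_row_lt (Nat.lt_succ_self i') ht hz
      have hz' := ih (i' + 1) j' (Or.inl hjj) hj' hz (by omega)
      obtain rfl : z = t + 1 := by omega
      rw [Finset.mem_coe, Finset.mem_filter, mem_cells_rect]
      exact ⟨T.lt_of_mem_entry_rect hz, Or.inl hjj, hz⟩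
    · rintro ⟨x, y⟩ - ⟨x', y'⟩ - he
      simpa using he
  · rcases hsi.eq_or_lt with h | h
    · omega
    · obtain ⟨i, rfl⟩ : ∃ k, i = k + 1 := ⟨i - 1, by omega⟩
      obtain ⟨y, hy, hay⟩ := (hs i j (by omega) hj).2 (by omega)
      have h1 := T.lt_of_row_lt (Nat.lt_succ_self i) hy hm
      have h2 := ih i j (Or.inr ⟨rfl, by simp⟩) hj hy hay
      omega

theorem mem_entry_iff_threshold {i j m : ℕ} (ham : a ≤ m) :
    m ∈ T.entry (i, j) ↔ (i < p ∧ j < q) ∧ s j ≤ i ∧ m + s j = a + i := by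
  constructor
  · intro hm
    have hij := T.lt_of_mem_entry_rect hm
    exact ⟨hij, (hs i j hij.1 hij.2).1 ⟨m, hm, ham⟩, add_threshold_eq_of_mem hT hb hs hm ham⟩
  · rintro ⟨hij, hsi, h⟩
    obtain ⟨x, hx, hax⟩ := (hs i j hij.1 hij.2).2 hsi
    have := add_threshold_eq_of_mem hT hb hs hx hax
    rwa [show m = x by omega]

theorem mem_iff_threshold {mu : YoungDiagram}
    (hcount : ∀ k, T.word.count (a + k) = mu.rowLen k) {i j : ℕ} (hi : i < p) (hj : j < q) :
    (p - 1 - i, q - 1 - j) ∈ mu ↔ s j ≤ i := by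
  have hcol := T.count_word_rect (a + (p - 1 - i)) (P := fun j => s j ≤ i) fun j hj => by
    constructor
    · intro h
      refine ⟨s j + (p - 1 - i), ?_⟩
      rw [mem_entry_iff_threshold hT hb hs (by omega)]
      omega
    · rintro ⟨i', hi'⟩
      rw [mem_entry_iff_threshold hT hb hs (by omega)] at hi'
      omega
  rw [YoungDiagram.mem_iff_lt_rowLen, ← hcount, hcol]
  refine lt_card_filter_range_iff_reflect (fun j j' hjj hj' h => ?_) hj
  rcases hjj.eq_or_lt with rfl | hlt
  · exact h
  obtain ⟨x, hx, hax⟩ := (hs i j hi (hlt.trans hj')).2 h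
  obtain ⟨y, hy⟩ := T.entry_rect_nonempty hi hj'
  exact (hs i j' hi hj').1 ⟨y, hy, hax.trans (T.le_of_col_lt hlt hx hy)⟩

end Large

theorem count_word_rect_le (t : ℕ) : T.word.count t ≤ q := by
  classical
  rw [T.count_word_rect t (P := fun j => ∃ i, t ∈ T.entry (i, j)) fun _ _ => Iff.rfl]
  exact (Finset.card_filter_le _ _).trans (by simp)

theorem exists_mem_entry_of_count_pos {t : ℕ} (ht : 0 < T.word.count t) :
    ∃ i j, t ∈ T.entry (i, j) := by
  rw [count_word, Finset.card_pos] at ht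
  obtain ⟨⟨i, j⟩, h⟩ := ht
  exact ⟨i, j, (Finset.mem_filter.1 h).2⟩

theorem exists_threshold_entry (a : ℕ) : ∃ s : ℕ → ℕ, (∀ j, s j ≤ p) ∧
    ∀ i j, i < p → j < q → ((∃ m ∈ T.entry (i, j), a ≤ m) ↔ s j ≤ i) := by
  have h : ∀ j, ∃ s, s ≤ p ∧ ∀ i, i < p → (j < q → ((∃ m ∈ T.entry (i, j), a ≤ m) ↔ s ≤ i)) := by
    intro j
    by_cases hj : j < q
    · obtain ⟨s, hs, h⟩ := exists_threshold p (fun i => ∃ m ∈ T.entry (i, j), a ≤ m)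
        fun i i' hii hi' ⟨m, hm, ham⟩ => by
          rcases hii.eq_or_lt with rfl | hlt
          · exact ⟨m, hm, ham⟩
          obtain ⟨y, hy⟩ := T.entry_rect_nonempty hi' hj
          exact ⟨y, hy, ham.trans (T.lt_of_row_lt hlt hm hy).le⟩
      exact ⟨s, hs, fun i hi _ => h i hi⟩
    · exact ⟨0, by simp, fun i _ hj' => absurd hj' hj⟩
  choose s hs h using h
  exact ⟨s, hs, fun i j hi hj => h j i hi hj⟩

end SVT

/-- The tableaux counted by `dCoeff`. -/
def IsCoproductTableau {cells : Finset (ℕ × ℕ)} (lam mu : YoungDiagram) (T : SVT cells) : Prop :=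
  IsPartialRLW 0 (lam.colLen 0) T.word ∧
    IsPartialRLW (lam.colLen 0) (lam.colLen 0 + mu.colLen 0) T.word ∧
    ∀ i, T.word.count i =
      if i < lam.colLen 0 then lam.rowLen i else mu.rowLen (i - lam.colLen 0)

namespace IsCoproductTableau

variable {p q : ℕ} {lam mu : YoungDiagram} {T : SVT (rect p q).cells}
  (h : IsCoproductTableau lam mu T)

include h

theorem count_of_lt {t : ℕ} (ht : t < lam.colLen 0) : T.word.count t = lam.rowLen t := by
  rw [h.2.2, if_pos ht]

theorem count_add (k : ℕ) : T.word.count (lam.colLen 0 + k) = mu.rowLen k := by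
  rw [h.2.2, if_neg (by omega), Nat.add_sub_cancel_left]

theorem lt_of_mem {c : ℕ × ℕ} {m : ℕ} (hm : m ∈ T.entry c) :
    m < lam.colLen 0 + mu.colLen 0 := by
  by_contra! hle
  have h1 := h.count_add (m - lam.colLen 0)
  rw [Nat.add_sub_cancel' (by omega), T.count_word] at h1
  have h2 : 0 < mu.rowLen (m - lam.colLen 0) := by
    rw [← h1]
    exact Finset.card_pos.2 ⟨c, Finset.mem_filter.2 ⟨T.mem_cells_of_mem_entry hm, hm⟩⟩
  rw [← YoungDiagram.mem_iff_lt_rowLen, YoungDiagram.mem_iff_lt_colLen] at h2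
  omega

theorem le_rect_left : lam ≤ rect p q := by
  rintro ⟨t, j⟩ hc
  have ht : t < lam.colLen 0 :=
    YoungDiagram.mem_iff_lt_colLen.1 (lam.up_left_mem le_rfl (Nat.zero_le j) hc)
  have hj : j < lam.rowLen t := YoungDiagram.mem_iff_lt_rowLen.1 hc
  rw [← h.count_of_lt ht] at hj
  obtain ⟨i, j', hi⟩ := T.exists_mem_entry_of_count_pos (Nat.zero_lt_of_lt hj)
  have := SVT.eq_row_of_mem h.1 hi ht
  exact mem_rect.2 ⟨this ▸ (T.lt_of_mem_entry_rect hi).1,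
    hj.trans_le (T.count_word_rect_le t)⟩

theorem le_rect_right : mu ≤ rect p q := by
  rintro ⟨k, j⟩ hc
  have hj : j < mu.rowLen k := YoungDiagram.mem_iff_lt_rowLen.1 hc
  rw [← h.count_add] at hj
  obtain ⟨i, j', hi⟩ := T.exists_mem_entry_of_count_pos (Nat.zero_lt_of_lt hj)
  obtain ⟨s, -, hs⟩ := T.exists_threshold_entry (lam.colLen 0)
  rw [SVT.mem_entry_iff_threshold h.2.1 (fun _ _ => h.lt_of_mem) hs (by omega)] at hi
  exact mem_rect.2 ⟨by simp only; omega, hj.trans_le (T.count_word_rect_le _)⟩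

theorem mem_entry_iff {i j m : ℕ} : m ∈ T.entry (i, j) ↔
    (i < p ∧ j < q) ∧ ((m = i ∧ (i, j) ∈ lam) ∨
      (i, j) ∈ muHat p q mu ∧ m + p = lam.colLen 0 + i + mu.colLen (q - 1 - j)) := by
  by_cases hij : i < p ∧ j < q
  swap
  · exact iff_of_false (fun hm => hij (T.lt_of_mem_entry_rect hm)) fun hm => hij hm.1
  simp only [mem_muHat, hij, and_self, true_and]
  obtain ⟨s, hsp, hs⟩ := T.exists_threshold_entry (lam.colLen 0)
  have hmu : ∀ i', i' < p → (p - 1 - i' < mu.colLen (q - 1 - j) ↔ s j ≤ i') := fun i' hi' => by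
    rw [← YoungDiagram.mem_iff_lt_colLen,
      SVT.mem_iff_threshold h.2.1 (fun _ _ => h.lt_of_mem) hs h.count_add hi' hij.2]
  have hlen : mu.colLen (q - 1 - j) ≤ p := by
    by_contra! hlt
    have := mem_rect.1 (h.le_rect_right (YoungDiagram.mem_iff_lt_colLen.2 hlt))
    simp at this
  have hsj : s j + mu.colLen (q - 1 - j) = p := by
    have := hsp j
    have h1 := hmu (s j)
    have h2 := hmu (s j - 1)
    omega
  have hsmall : (i, j) ∈ lam → i < lam.colLen 0 := fun hc =>
    YoungDiagram.mem_iff_lt_colLen.1 (lam.up_left_mem le_rfl (Nat.zero_le j) hc)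
  rw [YoungDiagram.mem_iff_lt_colLen (μ := mu), hmu i hij.1]
  by_cases hm : m < lam.colLen 0
  · rw [SVT.mem_entry_iff_of_lt h.1 (fun t => h.count_of_lt) hm]
    constructor
    · exact fun h' => Or.inl ⟨h'.1, h'.2.2⟩
    · rintro (h' | h')
      · exact ⟨h'.1, hij.2, h'.2⟩
      · omega
  · rw [SVT.mem_entry_iff_threshold h.2.1 (fun _ _ => h.lt_of_mem) hs (by omega)]
    constructor
    · exact fun h' => Or.inr ⟨h'.2.1, by omega⟩
    · rintro (h' | h')
      · have := hsmall h'.2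
        omega
      · exact ⟨hij, h'.1, by omega⟩

theorem eq {T' : SVT (rect p q).cells} (h' : IsCoproductTableau lam mu T') : T = T' := by
  have hT : T.entry = T'.entry := by
    ext ⟨i, j⟩ m
    rw [h.mem_entry_iff, h'.mem_entry_iff]
  cases T
  cases T'
  simpa using hT

theorem union_eq : lam.cells ∪ muHat p q mu = (rect p q).cells := by
  ext ⟨i, j⟩
  rw [Finset.mem_union, mem_cells_rect, YoungDiagram.mem_cells]
  constructor
  · rintro (hc | hc)
    · exact mem_rect.1 (h.le_rect_left hc)
    · exact (mem_muHat.1 hc).1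
  · intro hc
    obtain ⟨m, hm⟩ := T.entry_rect_nonempty hc.1 hc.2
    exact (h.mem_entry_iff.1 hm).2.imp And.right And.left

/-- A box in the overlap contains an entry for `lam` and an entry for `mu`. -/
theorem mem_entry_of_mem_inter {c : ℕ × ℕ} (hc : c ∈ lam.cells ∩ muHat p q mu) :
    ∃ x ∈ T.entry c, x < lam.colLen 0 ∧ ∃ y ∈ T.entry c, lam.colLen 0 ≤ y := by
  obtain ⟨i, j⟩ := c
  rw [Finset.mem_inter, YoungDiagram.mem_cells] at hc
  obtain ⟨hc, hc'⟩ := hc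
  have hi : i < lam.colLen 0 :=
    YoungDiagram.mem_iff_lt_colLen.1 (lam.up_left_mem le_rfl (Nat.zero_le j) hc)
  obtain ⟨hij, hmu⟩ := mem_muHat.1 hc'
  rw [YoungDiagram.mem_iff_lt_colLen] at hmu
  simp only at hij hmu
  refine ⟨i, h.mem_entry_iff.2 ⟨hij, Or.inl ⟨rfl, hc⟩⟩, hi,
    lam.colLen 0 + (i + mu.colLen (q - 1 - j) - p),
    h.mem_entry_iff.2 ⟨hij, Or.inr ⟨hc', ?_⟩⟩, ?_⟩ <;> omega

theorem isRookStripCells : IsRookStripCells (lam.cells ∩ muHat p q mu) := by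
  constructor <;> intro k <;> rw [Finset.card_le_one] <;> rintro ⟨i, j⟩ hc ⟨i', j'⟩ hd <;>
    rw [Finset.mem_filter] at hc hd <;> obtain ⟨hc, rfl⟩ := hc <;>
    obtain ⟨hd, hk⟩ := hd <;> simp only at hk <;> subst hk <;>
    obtain ⟨x, hx, hxa, y, hy, hya⟩ := h.mem_entry_of_mem_inter hc <;>
    obtain ⟨x', hx', hxa', y', hy', hya'⟩ := h.mem_entry_of_mem_inter hd
  · rcases lt_trichotomy j j' with hj | rfl | hj
    · have := T.le_of_col_lt hj hy hx'
      omega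
    · rfl
    · have := T.le_of_col_lt hj hy' hx
      omega
  · rcases lt_trichotomy i i' with hi | rfl | hi
    · have := T.lt_of_row_lt hi hy hx'
      omega
    · rfl
    · have := T.lt_of_row_lt hi hy' hx
      omega

end IsCoproductTableau

/-- The entries of the unique tableau counted by `dCoeff` for a rectangle. -/
def coproductEntry (p q : ℕ) (lam mu : YoungDiagram) (c : ℕ × ℕ) : Finset ℕ :=
  (if c ∈ lam.cells then {c.1} else ∅) ∪
    if c ∈ muHat p q mu then {lam.colLen 0 + (c.1 + mu.colLen (q - 1 - c.2) - p)} else ∅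

theorem mem_coproductEntry {p q : ℕ} {lam mu : YoungDiagram} {i j m : ℕ} :
    m ∈ coproductEntry p q lam mu (i, j) ↔ (m = i ∧ i < lam.colLen 0 ∧ (i, j) ∈ lam) ∨
      (i, j) ∈ muHat p q mu ∧ lam.colLen 0 ≤ m ∧
        m + p = lam.colLen 0 + i + mu.colLen (q - 1 - j) := by
  have hsmall : (i, j) ∈ lam → i < lam.colLen 0 := fun hc =>
    YoungDiagram.mem_iff_lt_colLen.1 (lam.up_left_mem le_rfl (Nat.zero_le j) hc)
  have hlarge : (i, j) ∈ muHat p q mu → p ≤ i + mu.colLen (q - 1 - j) := fun hc => by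
    rw [mem_muHat, YoungDiagram.mem_iff_lt_colLen] at hc
    simp only at hc
    omega
  rw [coproductEntry, Finset.mem_union]
  refine or_congr ?_ ?_
  · split_ifs with hc
    · have := hsmall hc
      simp only [YoungDiagram.mem_cells] at hc
      simp [hc, this]
    · simp only [YoungDiagram.mem_cells] at hc
      simp [hc]
  · split_ifs with hc
    · have := hlarge hc
      simp only [Finset.mem_singleton, hc, true_and]
      omega
    · simp [hc]

section Existence

variable {p q : ℕ} {lam mu : YoungDiagram} (hl : lam ≤ rect p q) (hm : mu ≤ rect p q)
  (hu : lam.cells ∪ muHat p q mu = (rect p q).cells)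
  (hr : IsRookStripCells (lam.cells ∩ muHat p q mu))

/-- The unique tableau counted by `dCoeff` for a rectangle. -/
def coproductTableau : SVT (rect p q).cells where
  entry := coproductEntry p q lam mu
  nonempty_of_mem c hc := by
    rw [← hu, Finset.mem_union] at hc
    rcases hc with hc | hc <;> simp [coproductEntry, hc]
  eq_empty_of_not_mem c hc := by
    rw [← hu, Finset.mem_union, not_or] at hc
    simp only [coproductEntry, hc, if_false, Finset.union_empty]
  row_weak i j h1 h2 a ha b hb := by
    rw [mem_coproductEntry] at ha hb
    rcases ha with ⟨rfl, ha, hla⟩ | ⟨hma, ha, hae⟩ <;>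
      rcases hb with ⟨rfl, hb, hlb⟩ | ⟨hmb, hb, hbe⟩
    · exact le_rfl
    · omega
    · exfalso
      have hla : (b, j) ∈ lam := lam.up_left_mem le_rfl (Nat.le_succ j) hlb
      have hmb : (b, j + 1) ∈ muHat p q mu := by
        rw [mem_cells_rect] at h2
        rw [mem_muHat] at hma ⊢
        exact ⟨h2, mu.up_left_mem le_rfl (by simp only; omega) hma.2⟩
      have := Finset.card_le_one.1 (hr.1 b) (b, j) (by simp [hla, hma])
        (b, j + 1) (by simp [hlb, hmb])
      simp at this
    · have := mu.colLen_anti (q - 1 - (j + 1)) (q - 1 - j) (by omega)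
      omega
  col_strict i j h1 h2 a ha b hb := by
    rw [mem_coproductEntry] at ha hb
    rcases ha with ⟨rfl, ha, hla⟩ | ⟨hma, ha, hae⟩ <;>
      rcases hb with ⟨rfl, hb, hlb⟩ | ⟨hmb, hb, hbe⟩
    · omega
    · omega
    · exfalso
      have hla : (i, j) ∈ lam := lam.up_left_mem (Nat.le_succ i) le_rfl hlb
      have hmb : (i + 1, j) ∈ muHat p q mu := by
        rw [mem_cells_rect] at h2
        rw [mem_muHat] at hma ⊢
        exact ⟨h2, mu.up_left_mem (by simp only; omega) le_rfl hma.2⟩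
      have := Finset.card_le_one.1 (hr.2 j) (i, j) (by simp [hla, hma])
        (i + 1, j) (by simp [hlb, hmb])
      simp at this
    · omega

theorem mem_coproductTableau_entry {i j m : ℕ} :
    m ∈ (coproductTableau hu hr).entry (i, j) ↔ (m = i ∧ i < lam.colLen 0 ∧ (i, j) ∈ lam) ∨
      (i, j) ∈ muHat p q mu ∧ lam.colLen 0 ≤ m ∧
        m + p = lam.colLen 0 + i + mu.colLen (q - 1 - j) :=
  mem_coproductEntry

include hl hm in
theorem isCoproductTableau_coproductTableau :
    IsCoproductTableau lam mu (coproductTableau hu hr) := by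
  have hlen : ∀ j, mu.colLen j ≤ p := fun j => by
    by_contra! hlt
    have := mem_rect.1 (hm (YoungDiagram.mem_iff_lt_colLen.2 hlt))
    simp at this
  have hwid : ∀ k, mu.rowLen k ≤ q := fun k => by
    by_contra! hlt
    have := mem_rect.1 (hm (YoungDiagram.mem_iff_lt_rowLen.2 hlt))
    simp at this
  refine ⟨fun w hw t _ ht => ?_, fun w hw t ht _ => ?_, fun t => ?_⟩
  · refine SVT.suffix_count_le_of_above _ (fun i j hij => ?_) w hw
    simp only [mem_coproductTableau_entry] at hij ⊢
    rcases hij with ⟨rfl, h1, h2⟩ | ⟨h1, h2, h3⟩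
    · exact ⟨t, rfl, Or.inl ⟨rfl, by omega, lam.up_left_mem (Nat.le_succ t) le_rfl h2⟩⟩
    · omega
  · refine SVT.suffix_count_le_of_above _ (fun i j hij => ?_) w hw
    simp only [mem_coproductTableau_entry] at hij ⊢
    rcases hij with ⟨rfl, h1, h2⟩ | ⟨h1, h2, h3⟩
    · omega
    · have := hlen (q - 1 - j)
      refine ⟨i - 1, by omega, Or.inr ⟨?_, ht, by omega⟩⟩
      rw [mem_muHat, YoungDiagram.mem_iff_lt_colLen] at h1 ⊢
      simp only at h1 ⊢
      omega
  · split_ifs with ht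
    · rw [SVT.count_word_rect _ t (P := fun j => j < lam.rowLen t) fun j _ => ?_]
      · have hq : lam.rowLen t ≤ q := by
          by_contra! hlt
          have := mem_rect.1 (hl (YoungDiagram.mem_iff_lt_rowLen.2 hlt))
          simp at this
        rw [show (Finset.range q).filter (fun j => j < lam.rowLen t) =
          Finset.range (lam.rowLen t) by ext; simp; omega, Finset.card_range]
      · simp only [mem_coproductTableau_entry, ← YoungDiagram.mem_iff_lt_rowLen]
        constructor
        · exact fun h => ⟨t, Or.inl ⟨rfl, ht, h⟩⟩
        · rintro ⟨i, ⟨rfl, h1, h2⟩ | h⟩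
          · exact h2
          · omega
    · obtain ⟨k, rfl⟩ : ∃ k, t = lam.colLen 0 + k := ⟨t - lam.colLen 0, by omega⟩
      rw [Nat.add_sub_cancel_left,
        SVT.count_word_rect _ _ (P := fun j => q - 1 - j < mu.rowLen k) fun j hj => ?_]
      · have := hwid k
        rw [show (Finset.range q).filter (fun j => q - 1 - j < mu.rowLen k) =
          Finset.Ico (q - mu.rowLen k) q by ext; simp; omega, Nat.card_Ico]
        omega
      · simp only [mem_coproductTableau_entry, ← YoungDiagram.mem_iff_lt_rowLen]
        rw [YoungDiagram.mem_iff_lt_colLen]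
        have := hlen (q - 1 - j)
        constructor
        · intro h
          refine ⟨k + p - mu.colLen (q - 1 - j), Or.inr ⟨?_, by omega, by omega⟩⟩
          rw [mem_muHat, YoungDiagram.mem_iff_lt_colLen]
          simp only
          omega
        · rintro ⟨i, ⟨rfl, h1, h2⟩ | ⟨h1, h2, h3⟩⟩
          · omega
          · have := (mem_muHat.1 h1).1
            simp only at this
            omega

end Existence

/-- **Multiplicity-free coproduct of a rectangle** (equation (13)): for the
`p × q` rectangle `R` and partitions `λ, μ`:  `d^R_{λμ} = (-1)^{|λ|+|μ|-pq}`
if `λ, μ ⊆ R`, `λ ∪ μ̂ = R` and `λ ∩ μ̂` is a rook strip, and `d^R_{λμ} = 0`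
otherwise. -/
theorem dCoeff_rectangle (p q : ℕ) (hp : 1 ≤ p) (hq : 1 ≤ q) (lam mu : YoungDiagram) :
    (lam ≤ rect p q → mu ≤ rect p q →
      lam.cells ∪ muHat p q mu = (rect p q).cells →
      IsRookStripCells (lam.cells ∩ muHat p q mu) →
      dCoeff lam mu (rect p q) = (-1 : ℤ) ^ (lam.card + mu.card - p * q)) ∧
    (¬(lam ≤ rect p q ∧ mu ≤ rect p q ∧
        lam.cells ∪ muHat p q mu = (rect p q).cells ∧
        IsRookStripCells (lam.cells ∩ muHat p q mu)) →
      dCoeff lam mu (rect p q) = 0) := by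
  have hcard : (rect p q).card = p * q := by simp [YoungDiagram.card, rect]
  have hd : dCoeff lam mu (rect p q) = (-1 : ℤ) ^ (lam.card + mu.card - p * q) *
      (Nat.card {T : SVT (rect p q).cells // IsCoproductTableau lam mu T} : ℤ) := by
    rw [← hcard]
    rfl
  rw [hd]
  refine ⟨fun hl hm hu hr => ?_, fun hnot => ?_⟩
  · have : Nat.card {T : SVT (rect p q).cells // IsCoproductTableau lam mu T} = 1 :=
      Nat.card_eq_one_iff_unique.2 ⟨⟨fun T T' => Subtype.ext (T.2.eq T'.2)⟩,
        ⟨⟨_, isCoproductTableau_coproductTableau hl hm hu hr⟩⟩⟩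
    rw [this, Nat.cast_one, mul_one]
  · have : IsEmpty {T : SVT (rect p q).cells // IsCoproductTableau lam mu T} :=
      ⟨fun T => hnot ⟨T.2.le_rect_left, T.2.le_rect_right, T.2.union_eq, T.2.isRookStripCells⟩⟩
    rw [Nat.card_of_isEmpty, Nat.cast_zero, mul_zero]
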